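/- The centroid of the Vidinli algebra is trivial: if θ : ℝ^{2n+1} → ℝ^{2n+1} is a linear map satisfying θ(x ∗ y) = θ(x) ∗ y = x ∗ θ(y) for all x, y ∈ ℝ^{2n+1}, then θ = λ · id for some λ ∈ ℝ. (Hence V_{2n+1} is ℝ-central.) -/

import Mathlib

noncomputable section

/-- Standard dot product on `ℝ^m`. -/
def dot {m : ℕ} (a b : Fin m → ℝ) : ℝ := ∑ i, a i * b i

/-- The distinguished unit vector `e₁` of the Vidinli algebra (index `0`). -/
def e1 (n : ℕ) : Fin (2*n+1) → ℝ := fun i => if i.val = 0 then 1 else 0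

/-- The standard symplectic form `ω` on `ℝ^{2n+1}` (vanishing on `e₁`):
`ω(a,b) = Σ_{k=1}^n (a_{2k} b_{2k+1} − a_{2k+1} b_{2k})` in the paper's 1-based indexing. -/
def omg (n : ℕ) (a b : Fin (2*n+1) → ℝ) : ℝ :=
  ∑ k : Fin n,
    (a ⟨2*k.val+1, by have := k.isLt; omega⟩ * b ⟨2*k.val+2, by have := k.isLt; omega⟩
   - a ⟨2*k.val+2, by have := k.isLt; omega⟩ * b ⟨2*k.val+1, by have := k.isLt; omega⟩)

/-- The Vidinli multiplication on `ℝ^{2n+1}`. -/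
def vprod (n : ℕ) (a b : Fin (2*n+1) → ℝ) : Fin (2*n+1) → ℝ :=
  dot a (e1 n) • b + dot b (e1 n) • a - dot a b • e1 n + omg n a b • e1 n

theorem dot_comm {m : ℕ} (a b : Fin m → ℝ) : dot a b = dot b a := by
  simp only [dot, mul_comm]

theorem dot_e1 (n : ℕ) (a : Fin (2*n+1) → ℝ) : dot a (e1 n) = a 0 := by
  have h : ∀ i : Fin (2*n+1), i.val = 0 ↔ i = 0 := fun _ => Fin.val_eq_zero_iff
  simp [dot, e1, h]

theorem omg_swap (n : ℕ) (a b : Fin (2*n+1) → ℝ) : omg n b a = -omg n a b := by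
  simp only [omg, ← Finset.sum_neg_distrib]
  exact Finset.sum_congr rfl fun k _ => by ring

theorem omg_e1 (n : ℕ) (b : Fin (2*n+1) → ℝ) : omg n (e1 n) b = 0 := by
  simp [omg, e1]

/-- `e₁` is a left unit. -/
theorem e1_vprod (n : ℕ) (x : Fin (2*n+1) → ℝ) : vprod n (e1 n) x = x := by
  rw [vprod, dot_comm (e1 n) x, omg_e1]
  simp [dot_e1, e1]

/-- `e₁` is a right unit. -/
theorem vprod_e1 (n : ℕ) (x : Fin (2*n+1) → ℝ) : vprod n x (e1 n) = x := by
  rw [vprod, omg_swap n (e1 n) x, omg_e1]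
  simp [dot_e1, e1]

theorem smul_vprod (n : ℕ) (r : ℝ) (x y : Fin (2*n+1) → ℝ) :
    vprod n (r • x) y = r • vprod n x y := by
  have hd : ∀ z, dot (r • x) z = r * dot x z := fun z => by
    simp [dot, Finset.mul_sum, mul_assoc]
  have ho : omg n (r • x) y = r * omg n x y := by
    simp only [omg, Finset.mul_sum, Pi.smul_apply, smul_eq_mul]
    exact Finset.sum_congr rfl fun k _ => by ring
  ext i
  simp only [vprod, hd, ho, dot_comm y, Pi.add_apply, Pi.sub_apply, Pi.smul_apply, smul_eq_mul]
  ring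

/-- Commuting elements are `ω`-orthogonal. -/
theorem omg_eq_zero_of_vprod_comm (n : ℕ) {x y : Fin (2*n+1) → ℝ}
    (h : vprod n x y = vprod n y x) : omg n x y = 0 := by
  have h0 := congrFun h 0
  simp only [vprod, dot_comm y x, omg_swap n x y, Pi.add_apply, Pi.sub_apply, Pi.smul_apply,
    smul_eq_mul, e1, Fin.val_zero, if_true] at h0
  linarith

/-- The radical of `ω` is spanned by `e₁`. -/
theorem eq_smul_e1_of_omg_eq_zero (n : ℕ) {c : Fin (2*n+1) → ℝ}
    (h : ∀ x, omg n c x = 0) : c = c 0 • e1 n := by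
  have hodd : ∀ k : Fin n, c ⟨2*k.val+1, by omega⟩ = 0 := fun k => by
    have hk := h (Pi.single ⟨2*k.val+2, by omega⟩ 1)
    have hne : ∀ j : Fin n, 2*j.val ≠ 2*k.val+1 := fun j => by omega
    simpa [omg, Pi.single_apply, Fin.ext_iff, hne, ← Fin.ext_iff] using hk
  have heven : ∀ k : Fin n, c ⟨2*k.val+2, by omega⟩ = 0 := fun k => by
    have hk := h (Pi.single ⟨2*k.val+1, by omega⟩ 1)
    have hne : ∀ j : Fin n, 2*j.val+2 ≠ 2*k.val+1 := fun j => by omega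
    simpa [omg, Pi.single_apply, Fin.ext_iff, hne, ← Fin.ext_iff] using hk
  ext ⟨i, hi⟩
  obtain rfl | ⟨k, rfl⟩ | ⟨k, rfl⟩ : i = 0 ∨ (∃ k, i = 2*k+1) ∨ ∃ k, i = 2*k+2 := by
    rcases Nat.even_or_odd' i with ⟨k, rfl | rfl⟩
    · rcases k with _ | k
      · simp
      · exact Or.inr (Or.inr ⟨k, by ring⟩)
    · exact Or.inr (Or.inl ⟨k, rfl⟩)
  · simp [e1]
  · simpa [e1] using hodd ⟨k, by omega⟩
  · simpa [e1] using heven ⟨k, by omega⟩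

/-- The centroid of the Vidinli algebra is trivial: any linear map
`θ` with `θ(x∗y) = θ(x)∗y = x∗θ(y)` is a real scalar multiple of the identity. -/
theorem vidinli_centroid_trivial (n : ℕ) (hn : 1 ≤ n)
    (θ : (Fin (2*n+1) → ℝ) →ₗ[ℝ] (Fin (2*n+1) → ℝ))
    (h1 : ∀ x y : Fin (2*n+1) → ℝ, θ (vprod n x y) = vprod n (θ x) y)
    (h2 : ∀ x y : Fin (2*n+1) → ℝ, θ (vprod n x y) = vprod n x (θ y)) :
    ∃ lam : ℝ, θ = lam • LinearMap.id := by
  have hl : ∀ x, θ x = vprod n (θ (e1 n)) x := fun x => by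
    rw [← h1, e1_vprod]
  have hr : ∀ x, θ x = vprod n x (θ (e1 n)) := fun x => by
    rw [← h2, vprod_e1]
  have hc := eq_smul_e1_of_omg_eq_zero n fun x =>
    omg_eq_zero_of_vprod_comm n ((hl x).symm.trans (hr x))
  refine ⟨θ (e1 n) 0, LinearMap.ext fun x => ?_⟩
  rw [hl, hc, smul_vprod, e1_vprod]
  simp [e1]
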